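/- Let G be an α_1-metric graph and x a vertex with e(x) ≥ rad(G)+2. Then the set ⋂{N(x) ∩ I(x,z) : z ∈ F(x)} is nonempty, and every vertex y in this set satisfies e(y) < e(x). -/

import Mathlib

open SimpleGraph

variable {V : Type*}

/-- `Itv G u v x` means `x` lies on a shortest `(u,v)`-path, i.e. `x ∈ I(u,v)`. -/
def Itv (G : SimpleGraph V) (u v x : V) : Prop :=
  G.dist u x + G.dist x v = G.dist u v

/-- `G` is an `α_i`-metric graph. -/
def AlphaI (G : SimpleGraph V) (i : ℕ) : Prop :=
  ∀ u v w x : V, Itv G u w v → Itv G v x w → G.Adj v w →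
    G.dist u v + G.dist v x ≤ G.dist u x + i

/-- Eccentricity of a vertex. -/
noncomputable def ecc (G : SimpleGraph V) [Fintype V] (v : V) : ℕ :=
  Finset.univ.sup (fun u => G.dist v u)

/-- Radius of the graph. -/
noncomputable def grad (G : SimpleGraph V) [Fintype V] [Nonempty V] : ℕ :=
  Finset.univ.inf' Finset.univ_nonempty (fun v => ecc G v)

/-- Diameter of the graph. -/
noncomputable def gdiam (G : SimpleGraph V) [Fintype V] : ℕ :=
  Finset.univ.sup (fun v => ecc G v)

namespace SimpleGraph

variable {G : SimpleGraph V}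

theorem Connected.exists_dist_eq_one (hG : G.Connected) {a b : V} (h : 0 < G.dist a b) :
    ∃ p, G.dist a p = 1 ∧ G.dist p b + 1 = G.dist a b := by
  obtain ⟨q, hq⟩ := (hG a b).exists_walk_length_eq_dist
  generalize hn : G.dist a b = n at *
  cases q with
  | nil => simp at hn; omega
  | @cons _ p _ hadj q =>
    refine ⟨p, dist_eq_one_iff_adj.2 hadj, ?_⟩
    have h1 := dist_le q
    have h2 := hG.dist_triangle (u := a) (v := p) (w := b)
    have h3 := dist_eq_one_iff_adj.2 hadj
    simp only [Walk.length_cons] at hq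
    omega

theorem Connected.exists_midpoint (hG : G.Connected) {a b : V} (h : G.dist a b = 2) :
    ∃ p, G.dist a p = 1 ∧ G.dist p b = 1 := by
  obtain ⟨p, hp, hpb⟩ := hG.exists_dist_eq_one (a := a) (b := b) (by omega)
  exact ⟨p, hp, by omega⟩

end SimpleGraph

namespace AlphaI

variable {G : SimpleGraph V}

theorem dist_add_dist_le (hα : AlphaI G 1) (hG : G.Connected) {x c w u : V}
    (h : G.dist x w + G.dist w c = G.dist x c) (hu : G.dist c u < G.dist w u) :
    G.dist x w + G.dist w u ≤ G.dist x u + 1 := by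
  induction hn : G.dist w c generalizing w with
  | zero =>
    obtain rfl := hG.dist_eq_zero_iff.1 hn
    omega
  | succ n ih =>
    obtain ⟨v, hwv, hvc⟩ := hG.exists_dist_eq_one (a := w) (b := c) (by omega)
    have h1 := hG.dist_triangle (u := x) (v := w) (w := v)
    have h2 := hG.dist_triangle (u := x) (v := v) (w := c)
    have h3 := hG.dist_triangle (u := w) (v := v) (w := u)
    by_cases hv : G.dist v u < G.dist w u
    · exact hα x w v u (by unfold Itv; omega) (by unfold Itv; omega) (dist_eq_one_iff_adj.1 hwv)
    · have := ih (w := v) (by omega) (by omega) (by omega)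
      omega

/-- Disks of `α₁`-metric graphs are convex. -/
theorem dist_le_of_between (hα : AlphaI G 1) (hG : G.Connected) {a b m u : V} {n : ℕ}
    (h : G.dist a m + G.dist m b = G.dist a b) (ha : G.dist a u ≤ n) (hb : G.dist b u ≤ n) :
    G.dist m u ≤ n := by
  by_contra hm
  have h1 := hα.dist_add_dist_le hG h (u := u) (by omega)
  obtain rfl := hG.dist_eq_zero_iff.1 (show G.dist a m = 0 by omega)
  omega

theorem dist_le_of_midpoint (hα : AlphaI G 1) (hG : G.Connected) {a b m u : V} {n : ℕ}
    (ham : G.dist a m = 1) (hmb : G.dist m b = 1) (hab : 1 < G.dist a b)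
    (ha : G.dist a u ≤ n) (hb : G.dist b u ≤ n) : G.dist m u ≤ n := by
  have := hG.dist_triangle (u := a) (v := m) (w := b)
  exact hα.dist_le_of_between hG (by omega) ha hb

theorem dist_le_one_of_common_neighbor (hα : AlphaI G 1) (hG : G.Connected) {a b m u : V} {n : ℕ}
    (ham : G.dist a m = 1) (hmb : G.dist m b = 1) (ha : G.dist a u ≤ n) (hb : G.dist b u ≤ n)
    (hm : n < G.dist m u) : G.dist a b ≤ 1 := by
  by_contra h
  have := hα.dist_le_of_midpoint hG ham hmb (by omega) ha hb
  omega

theorem square_has_chord (hα : AlphaI G 1) (hG : G.Connected) {a b c e : V}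
    (hab : G.dist a b = 1) (hbc : G.dist b c = 1) (hce : G.dist c e = 1) (hea : G.dist e a = 1) :
    G.dist a c ≤ 1 ∨ G.dist b e ≤ 1 := by
  by_contra! h
  have h1 := hα.dist_le_of_midpoint hG (m := e) (u := b) (n := 1)
    (by rw [dist_comm]; exact hea) (by rw [dist_comm]; exact hce) h.1 hab.le
    (by rw [dist_comm]; exact hbc.le)
  rw [dist_comm] at h1
  omega

/-- The triangle-pentagon condition for the edges at distance `k` from `u`. -/
def TrianglePentagonAt (G : SimpleGraph V) (u : V) (k : ℕ) : Prop :=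
  ∀ x w, G.dist x w = 1 → G.dist x u = k → G.dist w u = k →
    (∃ p, G.dist p x = 1 ∧ G.dist p w = 1 ∧ G.dist p u + 1 = k) ∨
      ∃ t, G.dist t x = 2 ∧ G.dist t w = 2 ∧ G.dist t u + 2 = k

theorem trianglePentagonAt (hα : AlphaI G 1) (hG : G.Connected) (u : V) {k : ℕ} (hk : 0 < k) :
    TrianglePentagonAt G u k := by
  have T := fun a b c : V => hG.dist_triangle (u := a) (v := b) (w := c)
  have S := fun a b : V => G.dist_comm (u := a) (v := b)
  induction k using Nat.strong_induction_on with
  | _ k ih =>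
  intro x w hxw hx hw
  by_contra hcon
  have N1 : ∀ p, G.dist p x ≤ 1 → G.dist p w ≤ 1 → G.dist p u + 1 = k → False := by
    intro p h1 h2 h3
    have := T x p u
    have := T w p u
    have := S x p
    have := S w p
    exact hcon (.inl ⟨p, by omega, by omega, h3⟩)
  have N2 : ∀ t, G.dist t x ≤ 2 → G.dist t w ≤ 2 → G.dist t u + 2 = k → False := by
    intro p h1 h2 h3
    have := T x p u
    have := T w p u
    have := S x p
    have := S w p
    exact hcon (.inr ⟨p, by omega, by omega, h3⟩)
  clear hcon
  have huu : G.dist u u = 0 := dist_self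
  have hk1 : k ≠ 1 := fun h => N1 u (by grind) (by grind) (by grind)
  have hk2 : k ≠ 2 := fun h => N2 u (by grind) (by grind) (by grind)
  have F : ∀ y v, G.dist x y = 1 → G.dist y u + 1 = k → G.dist w v = 1 → G.dist v u + 1 = k →
      G.dist y v = 2 := by
    intro y v hxy hyu hwv hvu
    have hyw : 1 < G.dist y w := by
      by_contra h
      exact N1 y (by grind) (by grind) hyu
    have hvx : 1 < G.dist v x := by
      by_contra h
      exact N1 v (by grind) (by grind) hvu
    have h3 : G.dist y v ≠ 3 := by
      intro h
      have := hα.dist_le_of_between hG (a := y) (b := v) (m := x) (u := u) (n := k - 1)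
        (by have := T y x v; have := T x w v; have := S x y; omega) (by omega) (by omega)
      omega
    have h1 : G.dist y v ≠ 1 := by
      intro h
      rcases hα.square_has_chord hG hxy h (by grind : G.dist v w = 1) (by grind) with h | h <;>
        grind
    have h0 : G.dist y v ≠ 0 := by
      intro h
      obtain rfl := hG.dist_eq_zero_iff.1 h
      grind
    have := T y x v
    have := T x w v
    have := S x y
    omega
  obtain ⟨y, hxy, hyu⟩ := hG.exists_dist_eq_one (a := x) (b := u) (by omega)
  obtain ⟨v, hwv, hvu⟩ := hG.exists_dist_eq_one (a := w) (b := u) (by omega)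
  have hyv := F y v hxy (by omega) hwv (by omega)
  obtain ⟨m, hym, hmv⟩ := hG.exists_midpoint hyv
  have hmu : G.dist m u ≤ k - 1 :=
    hα.dist_le_of_between hG (a := y) (b := v) (by omega) (by omega) (by omega)
  have hmu' : G.dist m u = k - 1 := by
    by_contra h
    exact N2 m (by have := T m y x; have := S y m; have := S x y; omega)
      (by have := T m v w; have := S w v; omega) (by have := T y m u; omega)
  have swing : ∀ t z, G.dist t x ≤ 2 → G.dist t z ≤ 2 → G.dist w z = 1 → G.dist z u + 1 = k →
      G.dist t u + 2 = k → False := by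
    intro t z htx htz hwz hzu htu
    have hxz : 1 < G.dist x z := by
      by_contra h
      exact N1 z (by grind) (by grind) hzu
    have := hα.dist_le_of_midpoint hG hxw hwz hxz (by grind : G.dist x t ≤ 2) (by grind)
    exact N2 t htx (by grind) htu
  have TC : ∀ t, G.dist t y ≤ 1 → G.dist t m ≤ 1 → G.dist t u + 2 = k → False := by
    intro t hty htm htu
    exact swing t v (by have := T t y x; have := S x y; omega) (by have := T t m v; omega) hwv (by omega) htu
  rcases ih (k - 1) (by omega) (by omega) y m hym (by omega) hmu' with
    ⟨t, hty, htm, htu⟩ | ⟨g, hgy, hgm, hgu⟩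
  · exact TC t hty.le htm.le (by omega)
  obtain ⟨t, hgt, hty⟩ := hG.exists_midpoint hgy
  obtain ⟨s, hgs, hsm⟩ := hG.exists_midpoint hgm
  have htu : G.dist t u + 2 = k := by
    have := T t g u
    have := S g t
    have := T y t u
    have := S y t
    omega
  have hsu : G.dist s u + 2 = k := by
    have := T s g u
    have := S g s
    have := T m s u
    have := S m s
    omega
  have hts : 1 < G.dist t s := by
    by_contra h
    rcases Nat.le_one_iff_eq_zero_or_eq_one.1 (not_lt.1 h) with h | h
    · obtain rfl := hG.dist_eq_zero_iff.1 h
      exact TC t hty.le hsm.le htu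
    · rcases hα.square_has_chord hG (by grind : G.dist y t = 1) h hsm (by grind) with h | h
      · exact TC s (by grind) hsm.le hsu
      · exact TC t hty.le h htu
  have htx : G.dist t x ≤ 2 := by
    have := T t y x
    have := S x y
    omega
  have hgw : G.dist g w ≤ 3 :=
    hα.dist_le_of_midpoint hG (by grind : G.dist t g = 1) hgs hts
      (by have := T t x w; omega)
      (by have := T s m v; have := T s v w; have := S w v; omega)
  have hwg : G.dist w g = 3 := by
    have := T w g u
    have := S w g
    omega
  obtain ⟨z, hwz, hzg⟩ := hG.exists_dist_eq_one (a := w) (b := g) (by omega)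
  obtain ⟨h, hzh, hhg⟩ := hG.exists_midpoint (show G.dist z g = 2 by omega)
  have hzu : G.dist z u + 1 = k := by
    have := T w z u
    have := T z g u
    omega
  have hhu : G.dist h u + 2 = k := by
    have := T z h u
    have := T h g u
    omega
  obtain ⟨q, hyq, hqz⟩ := hG.exists_midpoint (F y z hxy (by omega) hwz hzu)
  by_cases hqh : G.dist q h ≤ 1
  · have hyw : 1 < G.dist y w := by
      by_contra h
      exact N1 y (by grind) (by grind) (by omega)
    have := hα.dist_le_of_midpoint hG (by grind : G.dist y x = 1) hxw hyw (u := h) (n := 2)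
      (by have := T y q h; omega) (by have := T w z h; omega)
    exact N2 h (by grind) (by grind) hhu
  · have := hα.dist_le_of_midpoint hG hqz hzh (by omega) (u := t) (n := 2)
      (by have := T q y t; have := S y q; have := S t y; omega)
      (by have := T h g t; have := S g t; omega)
    exact swing t z htx (by grind) hwz hzu htu

theorem exists_common_neighbor_of_between (hα : AlphaI G 1) (hG : G.Connected) {w u s c : V}
    (hs : G.dist w s + G.dist s u = G.dist w u) (hc : G.dist w c + G.dist c u = G.dist w u)
    (hsc : G.dist s c = 1) (hsu : G.dist s u = G.dist c u) (h0 : 0 < G.dist c u) :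
    ∃ v, G.dist v s = 1 ∧ G.dist v c = 1 ∧ G.dist v u + 1 = G.dist c u := by
  have T := fun a b c : V => hG.dist_triangle (u := a) (v := b) (w := c)
  have S := fun a b : V => G.dist_comm (u := a) (v := b)
  by_contra hcon
  replace hcon : ∀ v, G.dist v s ≤ 1 → G.dist v c ≤ 1 → G.dist v u + 1 = G.dist c u → False := by
    intro v h1 h2 h3
    have := T s v u
    have := T c v u
    have := S s v
    have := S c v
    exact hcon ⟨v, by omega, by omega, h3⟩
  rcases hα.trianglePentagonAt hG u h0 s c hsc hsu rfl with ⟨v, h1, h2, h3⟩ | ⟨g, hgs, hgc, hgu⟩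
  · exact hcon v h1.le h2.le h3
  obtain ⟨a, hga, has⟩ := hG.exists_midpoint hgs
  obtain ⟨v, hgv, hvc⟩ := hG.exists_midpoint hgc
  have hau : G.dist a u + 1 = G.dist c u := by
    have := T a g u
    have := S g a
    have := T s a u
    have := S s a
    omega
  have hvu : G.dist v u + 1 = G.dist c u := by
    have := T v g u
    have := S g v
    have := T c v u
    have := S c v
    omega
  have hav : 1 < G.dist a v := by
    by_contra h
    rcases Nat.le_one_iff_eq_zero_or_eq_one.1 (not_lt.1 h) with h | h
    · obtain rfl := hG.dist_eq_zero_iff.1 h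
      exact hcon a has.le hvc.le hau
    · rcases hα.square_has_chord hG (by grind : G.dist s a = 1) h hvc (by grind) with h | h
      · exact hcon v (by grind) hvc.le hvu
      · exact hcon a has.le h hau
  have := hα.dist_le_of_midpoint hG (by grind : G.dist a g = 1) hgv hav (u := w)
    (n := G.dist w s + 1)
    (by have := T a s w; have := S s w; omega)
    (by have := T v c w; have := S c w; omega)
  have := T w g u
  have := S w g
  omega

theorem exists_common_step_of_dist_eq_three (hα : AlphaI G 1) (hG : G.Connected)
    {x w v c u : V} {k : ℕ}
    (hxw : G.dist x w = 1) (hwv : G.dist w v = 1) (hvc : G.dist v c = 1) (hxc : G.dist x c = 3)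
    (hxu : G.dist x u = k) (hwu : G.dist w u = k) (hvu : G.dist v u + 1 = k)
    (hcu : G.dist c u + 2 = k) :
    ∃ p, G.dist x p = 1 ∧ G.dist p u + 1 = k ∧ G.dist p c = 2 := by
  have T := fun a b c : V => hG.dist_triangle (u := a) (v := b) (w := c)
  have S := fun a b : V => G.dist_comm (u := a) (v := b)
  by_contra hcon
  replace hcon : ∀ p, G.dist x p = 1 → G.dist p u + 1 = k → G.dist p c ≤ 2 → False := by
    intro p h1 h2 h3
    exact hcon ⟨p, h1, h2, by have := T x p c; omega⟩
  have hk : 3 ≤ k := by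
    have := T x u c
    have := S c u
    omega
  have hxv : G.dist x v = 2 := by
    have := T x w v
    have := T x v c
    omega
  have hwc : G.dist w c = 2 := by
    have := T w v c
    have := T x w c
    omega
  rcases hα.trianglePentagonAt hG u (by omega) x w hxw hxu hwu with
    ⟨p, hpx, hpw, hpu⟩ | ⟨t, htx, htw, htu⟩
  · have := hα.dist_le_one_of_common_neighbor hG hpw hwv (u := u) (n := k - 1)
      (by omega) (by omega) (by omega)
    exact hcon p (by grind) hpu (by have := T p v c; omega)
  obtain ⟨y, hty, hyx⟩ := hG.exists_midpoint htx
  obtain ⟨w', htw', hw'w⟩ := hG.exists_midpoint htw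
  have hyu : G.dist y u + 1 = k := by
    have := T y t u
    have := S t y
    have := T x y u
    have := S x y
    omega
  have hw'u : G.dist w' u + 1 = k := by
    have := T w' t u
    have := S t w'
    have := T w w' u
    have := S w w'
    omega
  have hw'v := hα.dist_le_one_of_common_neighbor hG hw'w hwv (u := u) (n := k - 1)
    (by omega) (by omega) (by omega)
  have htc : G.dist t c = 2 := by
    have h1 : 1 < G.dist t c := by
      by_contra h
      exact hcon y (by have := S x y; omega) hyu (by have := T y t c; have := S t y; omega)
    have h3 : G.dist t c ≠ 3 := by
      intro h
      have := hα.dist_le_of_between hG (a := t) (b := c) (m := v) (u := u) (n := k - 2)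
        (by have := T t w' v; have := T t v c; omega) (by omega) (by omega)
      omega
    have := T t w' v
    have := T t v c
    omega
  obtain ⟨s, hts, hsc⟩ := hG.exists_midpoint htc
  have hsu : G.dist s u ≤ k - 2 :=
    hα.dist_le_of_midpoint hG hts hsc (by omega) (by omega) (by omega)
  have hsw : G.dist s w ≤ 2 :=
    hα.dist_le_of_midpoint hG hts hsc (by omega) (by omega) (by grind)
  have := T w s u
  have := S w s
  have := S w t
  have := S s t
  obtain ⟨a, has, hat, hau⟩ := hα.exists_common_neighbor_of_between hG (w := w) (u := u)
    (s := s) (c := t) (by omega) (by omega) (by omega) (by omega) (by omega)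
  obtain ⟨b, hbs, hbc, hbu⟩ := hα.exists_common_neighbor_of_between hG (w := w) (u := u)
    (s := s) (c := c) (by omega) (by omega) (by omega) (by omega) (by omega)
  have hab : G.dist a b ≤ 1 := hα.dist_le_one_of_common_neighbor hG has
    (by grind : G.dist s b = 1) (u := u) (n := k - 3) (by omega) (by omega) (by omega)
  have far : ∀ z, G.dist z w ≤ 2 → G.dist z u + 3 = k → False := by
    intro z h1 h2
    have := T w z u
    have := S w z
    omega
  have hac : 1 < G.dist a c := by
    by_contra h
    have hac1 : G.dist a c = 1 := by have := T t a c; have := S t a; omega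
    exact far a (hα.dist_le_of_midpoint hG (by grind : G.dist t a = 1) hac1 (by omega)
      (by omega) (by grind)) (by omega)
  have hbx : G.dist b x ≤ 3 :=
    hα.dist_le_of_between hG (a := a) (b := c) (by have := T a b c; omega)
      (by have := T a t x; omega) (by grind)
  have hxb : G.dist x b = 3 := by
    have := T x b u
    have := S x b
    omega
  obtain ⟨p, hxp, hpb⟩ := hG.exists_dist_eq_one (a := x) (b := b) (by omega)
  obtain ⟨q, hpq, hqb⟩ := hG.exists_midpoint (show G.dist p b = 2 by omega)
  have hpu : G.dist p u + 1 = k := by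
    have := T x p u
    have := T p b u
    omega
  have hqc : G.dist q c ≤ 2 := by have := T q b c; omega
  have hpc : 2 < G.dist p c := by
    by_contra h
    exact hcon p hxp hpu (by omega)
  have hpv : G.dist p v = 2 := by
    have h3 : G.dist p v ≠ 3 := by
      intro h
      have := hα.dist_le_of_between hG (a := p) (b := v) (m := x) (u := u) (n := k - 1)
        (by have := S x p; omega) (by omega) (by omega)
      omega
    have := T p x v
    have := S x p
    have := T p v c
    omega
  obtain ⟨m, hpm, hmv⟩ := hG.exists_midpoint hpv
  have hmq := hα.dist_le_one_of_common_neighbor hG (by grind : G.dist m p = 1) hpq (u := c)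
    (n := 2) (by have := T m v c; omega) hqc hpc
  have hwq : G.dist w q ≤ 2 := hα.dist_le_of_midpoint hG hxw hwv (by omega)
    (by have := T x p q; omega) (by have := T v m q; have := S m v; have := S v q; omega)
  exact far b (hα.dist_le_of_midpoint hG hqb hbc (by have := T p q c; omega)
    (by have := S q w; omega) (by grind)) (by omega)

theorem exists_common_step (hα : AlphaI G 1) (hG : G.Connected) {x c u : V}
    (h : G.dist c u + 2 ≤ G.dist x u) :
    ∃ p, G.dist x p = 1 ∧ G.dist p u + 1 = G.dist x u ∧ G.dist p c + 1 = G.dist x c := by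
  have T := fun a b c : V => hG.dist_triangle (u := a) (v := b) (w := c)
  have hxc := T x c u
  obtain ⟨w, hxw, hwc⟩ := hG.exists_dist_eq_one (a := x) (b := c) (by omega)
  have := T x w u
  by_cases hw : G.dist w u < G.dist x u
  · exact ⟨w, hxw, by omega, hwc⟩
  have hwu := hα.dist_add_dist_le hG (x := x) (w := w) (c := c) (u := u) (by omega) (by omega)
  obtain ⟨v, hwv, hvc⟩ := hG.exists_dist_eq_one (a := w) (b := c) (by omega)
  have := T w v u
  have := T x w v
  have := T x v c
  have hvu := hα.dist_add_dist_le hG (x := x) (w := v) (c := c) (u := u) (by omega) (by omega)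
  have := T v c u
  obtain ⟨z, hvz, hzc⟩ := hG.exists_dist_eq_one (a := v) (b := c) (by omega)
  have := T v z u
  have := T x v z
  have := T x z c
  have hzu : G.dist z u + 2 = G.dist x u := by
    by_contra hne
    have := hα.dist_add_dist_le hG (x := x) (w := z) (c := c) (u := u) (by omega) (by omega)
    omega
  obtain ⟨p, hxp, hpu, hpz⟩ := hα.exists_common_step_of_dist_eq_three hG hxw hwv hvz (by omega)
    rfl (by omega) (by omega) hzu
  have := T p z c
  have := T x p c
  exact ⟨p, hxp, hpu, by omega⟩

end AlphaI

theorem dist_le_ecc [Fintype V] (G : SimpleGraph V) (v u : V) : G.dist v u ≤ ecc G v :=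
  Finset.le_sup (f := fun u => G.dist v u) (Finset.mem_univ u)

theorem exists_dist_eq_ecc [Fintype V] [Nonempty V] (G : SimpleGraph V) (v : V) :
    ∃ u, G.dist v u = ecc G v := by
  obtain ⟨u, -, hu⟩ := Finset.exists_mem_eq_sup Finset.univ Finset.univ_nonempty
    (fun u => G.dist v u)
  exact ⟨u, hu.symm⟩

theorem exists_ecc_eq_grad [Fintype V] [Nonempty V] (G : SimpleGraph V) :
    ∃ c, ecc G c = grad G := by
  obtain ⟨c, -, hc⟩ := Finset.exists_mem_eq_inf' Finset.univ_nonempty (fun v => ecc G v)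
  exact ⟨c, hc.symm⟩

theorem AlphaI.exists_gate_to_furthest [Fintype V] [Nonempty V] {G : SimpleGraph V}
    (hα : AlphaI G 1) (hG : G.Connected) {x : V} (hx : grad G + 2 ≤ ecc G x) :
    ∃ y, G.Adj x y ∧ ∀ z, G.dist x z = ecc G x → Itv G x z y := by
  classical
  have T := fun a b c : V => hG.dist_triangle (u := a) (v := b) (w := c)
  have S := fun a b : V => G.dist_comm (u := a) (v := b)
  obtain ⟨c, hc⟩ := exists_ecc_eq_grad G
  have hcu : ∀ u, G.dist c u + 2 ≤ ecc G x := fun u => by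
    have := dist_le_ecc G c u
    omega
  let K : Finset V := {w | G.dist x w = 1 ∧ G.dist w c + 1 = G.dist x c}
  let cov : V → Finset V := fun w => {z | G.dist x z = ecc G x ∧ G.dist w z < ecc G x}
  have step : ∀ u, G.dist x u = ecc G x → ∃ p ∈ K, u ∈ cov p := by
    intro u hu
    obtain ⟨p, h1, h2, h3⟩ := hα.exists_common_step hG (x := x) (c := c) (u := u)
      (by have := hcu u; omega)
    exact ⟨p, (Finset.mem_filter_univ _).2 ⟨h1, h3⟩, (Finset.mem_filter_univ _).2 ⟨hu, by omega⟩⟩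
  have hK : K.Nonempty := by
    obtain ⟨u, hu⟩ := exists_dist_eq_ecc G x
    obtain ⟨p, hp, -⟩ := step u hu
    exact ⟨p, hp⟩
  obtain ⟨w, hwK, hmax⟩ := K.exists_max_image (fun w => (cov w).card) hK
  have hw : G.dist x w = 1 ∧ G.dist w c + 1 = G.dist x c := (Finset.mem_filter.1 hwK).2
  refine ⟨w, dist_eq_one_iff_adj.1 hw.1, fun u hu => ?_⟩
  suffices hwu : G.dist w u < ecc G x by
    have := T x w u
    unfold Itv
    omega
  by_contra hwu
  obtain ⟨p, hpK, hup⟩ := step u hu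
  have hp : G.dist x p = 1 ∧ G.dist p c + 1 = G.dist x c := (Finset.mem_filter.1 hpK).2
  have hpu : G.dist x u = ecc G x ∧ G.dist p u < ecc G x := (Finset.mem_filter.1 hup).2
  obtain ⟨z, hzw, hzp⟩ : ∃ z ∈ cov w, z ∉ cov p := by
    by_contra! hsub
    have hlt := Finset.card_lt_card (Finset.ssubset_iff_subset_ne.2
      ⟨(hsub : cov w ⊆ cov p), fun h => hwu (by
        rw [← h] at hup
        exact (Finset.mem_filter.1 hup).2.2)⟩)
    have := hmax p hpK
    omega
  have hz : G.dist x z = ecc G x ∧ G.dist w z < ecc G x := (Finset.mem_filter.1 hzw).2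
  have hpz : ecc G x ≤ G.dist p z := by
    by_contra h
    exact hzp ((Finset.mem_filter_univ _).2 ⟨hz.1, by omega⟩)
  have hpw : G.dist p w ≤ 1 := hα.dist_le_one_of_common_neighbor hG
    (by rw [S]; exact hp.1) hw.1 (u := c) (n := G.dist x c - 1) (by omega) (by omega) (by omega)
  have h1 := T x p u
  have h2 := T x w z
  have h3 := T p w z
  have h4 := T w p u
  have h5 := S p w
  have h6 := S p u
  have h7 := S w u
  have h8 := hα u p w z (by unfold Itv; omega) (by unfold Itv; omega)
    (dist_eq_one_iff_adj.1 (by omega))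
  have h9 := T u c z
  have h10 := S u c
  have h11 := hcu u
  have h12 := hcu z
  omega

theorem AlphaI.ecc_lt_of_gate [Fintype V] [Nonempty V] {G : SimpleGraph V}
    (hα : AlphaI G 1) (hG : G.Connected) {x y : V} (hx : grad G + 2 ≤ ecc G x)
    (hxy : G.Adj x y) (hy : ∀ z, G.dist x z = ecc G x → Itv G x z y) : ecc G y < ecc G x := by
  by_contra hlt
  have T := fun a b c : V => hG.dist_triangle (u := a) (v := b) (w := c)
  have S := fun a b : V => G.dist_comm (u := a) (v := b)
  have h1 := dist_eq_one_iff_adj.2 hxy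
  obtain ⟨c, hc⟩ := exists_ecc_eq_grad G
  obtain ⟨z, hz⟩ := exists_dist_eq_ecc G x
  obtain ⟨u, hu⟩ := exists_dist_eq_ecc G y
  have hyz := hy z hz
  have h2 := dist_le_ecc G x u
  have h3 := T y x u
  have h4 := S y x
  have hne : G.dist x u ≠ ecc G x := fun h => by
    have := hy u h
    unfold Itv at this
    omega
  have h5 := hα u x y z (by unfold Itv; have := S u x; have := S u y; omega) hyz hxy
  have h6 := T u c z
  have h7 := S u c
  have h8 := dist_le_ecc G c u
  have h9 := dist_le_ecc G c z
  have h10 := S u x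
  omega

theorem stmt_19 [Fintype V] [Nonempty V] (G : SimpleGraph V) (hG : G.Connected)
    (hα : AlphaI G 1) (x : V) (hx : grad G + 2 ≤ ecc G x) :
    (∃ y : V, G.Adj x y ∧ ∀ z : V, G.dist x z = ecc G x → Itv G x z y) ∧
    (∀ y : V, G.Adj x y → (∀ z : V, G.dist x z = ecc G x → Itv G x z y) →
      ecc G y < ecc G x) := by
  exact ⟨hα.exists_gate_to_furthest hG hx, fun y hxy hy => hα.ecc_lt_of_gate hG hx hxy hy⟩
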